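/- Let r = I_0, I_1, …, I_m be a quasi-run of a one-state PDA with m > 1, and let d = |stack(I_1)|. Then there exist positions p_0 = 1 < p_1 < … < p_d = m, where each p_i (1 ≤ i ≤ d) is the least position with stack(I_{p_i}) = (stack(I_{p_{i−1}}))_≪, and for each i the sequence r_i = I_{p_{i−1}}/I_{p_i}, …, I_{p_i}/I_{p_i} is a quasi-run whose initial stack content is the single symbol (stack(I_1))_i; thus r disassembles into its first move I_0 ⊢ I_1 and the d quasi-runs r_1, …, r_d. -/

import Mathlib

/-- The two-letter Dyck alphabet: `D.ab` is `ā` (the opening symbol) and `D.a` is `a`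
(the closing symbol). -/
inductive D where
  | ab : D  -- ā
  | a : D   -- a
deriving DecidableEq

/-- Parse trees of the grammar `G_D = ({S}, {ā, a}, S, {S → ā S a S, S → ε})`:
`eps` is an application of `S → ε` and `node t₁ t₂` an application of `S → ā S a S`. -/
inductive DyckTree where
  | eps : DyckTree
  | node : DyckTree → DyckTree → DyckTree

/-- The word generated by a parse tree of `G_D`. -/
def DyckTree.yield : DyckTree → List D
  | .eps => []
  | .node t₁ t₂ => D.ab :: (t₁.yield ++ D.a :: t₂.yield)

/-- The Dyck language `L_D`: the language generated by `G_D`. -/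
def LD : Set (List D) := { w | ∃ t : DyckTree, t.yield = w }

/-- `Matches t i j` holds iff positions `i < j` (0-indexed) of the word `t.yield` form a
matching pair: position `i` carries `ā`, position `j` carries `a`, and the two
corresponding leaves have the same parent in the parse tree `t`. -/
inductive Matches : DyckTree → ℕ → ℕ → Prop
  | head (t₁ t₂ : DyckTree) : Matches (.node t₁ t₂) 0 (t₁.yield.length + 1)
  | left {t₁ : DyckTree} {i j : ℕ} (t₂ : DyckTree) :
      Matches t₁ i j → Matches (.node t₁ t₂) (i + 1) (j + 1)
  | right {t₂ : DyckTree} {i j : ℕ} (t₁ : DyckTree) :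
      Matches t₂ i j → Matches (.node t₁ t₂) (t₁.yield.length + 2 + i) (t₁.yield.length + 2 + j)

/-- `DelStep w v`: `v` results from `w ∈ L_D` by deleting (both positions of) one
matching pair of `w`. -/
def DelStep (w v : List D) : Prop :=
  ∃ (t : DyckTree) (i j : ℕ), t.yield = w ∧ Matches t i j ∧
    v = (w.eraseIdx j).eraseIdx i

/-- The ordering `≼` on Dyck words: `dyckLE v w` (i.e. `v ≼ w`) holds iff `v` results
from `w` by deleting 0 or more matching pairs. -/
def dyckLE (v w : List D) : Prop := Relation.ReflTransGen DelStep w v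

/-- The harmonics: `h_0 = ε` and `h_{i+1} = ā h_i a ā h_i a`. -/
def harmonicW : ℕ → List D
  | 0 => []
  | i + 1 => (D.ab :: (harmonicW i ++ [D.a])) ++ (D.ab :: (harmonicW i ++ [D.a]))

/-- `ĥ_i = ā h_i a`. -/
def hatHarmonic (i : ℕ) : List D := D.ab :: (harmonicW i ++ [D.a])

/-- The rank of a Dyck word `w`: the greatest `q` such that `h_q ≼ w`. -/
noncomputable def rank (w : List D) : ℕ := sSup { q : ℕ | dyckLE (harmonicW q) w }

/-- A pushdown automaton with states `Q`, input alphabet `σ` and stack alphabet `Γ`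
(the types `Q`, `σ`, `Γ` are meant to be finite, which is required where relevant):
`δ` is the set of actions, an action `(q, b, γ, p, ξ)` standing for
`(q, b, γ) ↪ (p, ξ)` with `b ∈ Σ ∪ {ε}` encoded by `Option σ`; `q0` is the start state
and `γ0` the start stack symbol. Acceptance is by empty stack. -/
structure PDA (Q σ Γ : Type) where
  δ : Set (Q × Option σ × Γ × Q × List Γ)
  q0 : Q
  γ0 : Γ

/-- An instantaneous descriptor: state, remaining input, stack content. -/
structure ID (Q σ Γ : Type) where
  state : Q
  tape : List σ
  stack : List Γ

/-- The move relation: an action `(q, b, γ) ↪ (p, ξ′)` induces the move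
`(q, b w, γ ξ) ⊢ (p, w, ξ′ ξ)`. -/
def PDA.Move {Q σ Γ : Type} (P : PDA Q σ Γ) (I I' : ID Q σ Γ) : Prop :=
  ∃ (b : Option σ) (γ : Γ) (ξ rest : List Γ),
    (I.state, b, γ, I'.state, ξ) ∈ P.δ ∧
    I.stack = γ :: rest ∧ I'.stack = ξ ++ rest ∧
    I.tape = b.toList ++ I'.tape

/-- A quasi-run: a move sequence `I₀ ⊢ I₁ ⊢ … ⊢ I_m` such that the stack of `I₀` is a
single symbol and the stack of `I_m` is empty (represented as the list `[I₀, …, I_m]`). -/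
def PDA.IsQuasiRun {Q σ Γ : Type} (P : PDA Q σ Γ) (r : List (ID Q σ Γ)) : Prop :=
  r.Chain' P.Move ∧
  (∃ (I : ID Q σ Γ) (γ : Γ), r.head? = some I ∧ I.stack = [γ]) ∧
  (∃ I' : ID Q σ Γ, r.getLast? = some I' ∧ I'.stack = [])

/-- A run on input `w`: a quasi-run whose first ID is the initial ID `(q₀, w, γ₀)` and
whose last ID has empty tape (and, being a quasi-run, empty stack). -/
def PDA.IsRun {Q σ Γ : Type} (P : PDA Q σ Γ) (w : List σ) (r : List (ID Q σ Γ)) : Prop :=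
  P.IsQuasiRun r ∧ r.head? = some ⟨P.q0, w, [P.γ0]⟩ ∧
  (∃ I' : ID Q σ Γ, r.getLast? = some I' ∧ I'.tape = [])

/-- The language of `P` (acceptance by empty stack). -/
def PDA.lang {Q σ Γ : Type} (P : PDA Q σ Γ) : Set (List σ) := { w | ∃ r, P.IsRun w r }

/-- The footprint `α′(r)` of a quasi-run `r = I₀, …, I_m`, defined in the paper by
disassembly: `α′(r) = a` if `m = 1`, and `α′(r) = a ā^d α′(r₁) … α′(r_d)` if `m > 1`,
where `d = |stack(I₁)|` and `r₁, …, r_d` is the disassembly of `r`.  Equivalently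
(unfolding the disassembly), each move `I ⊢ I'` contributes `a` (for the popped
symbol) followed by `ā^{|ξ|}` where `|ξ| = |stack(I')| + 1 − |stack(I)|` is the number
of pushed symbols; this computation is used here. -/
def alphaQR' {Q σ Γ : Type} : List (ID Q σ Γ) → List D
  | I :: I' :: rest =>
      (D.a :: List.replicate (I'.stack.length + 1 - I.stack.length) D.ab) ++
        alphaQR' (I' :: rest)
  | _ => []

/-- The footprint `α(r) = ā α′(r)` of a quasi-run `r`. -/
def alphaQR {Q σ Γ : Type} (r : List (ID Q σ Γ)) : List D := D.ab :: alphaQR' r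

/-- The oscillation of a quasi-run: `osc(r) = rank(α(r))`. -/
noncomputable def oscQR {Q σ Γ : Type} (r : List (ID Q σ Γ)) : ℕ := rank (alphaQR r)

/-- `L^(k)(P)`: the set of words accepted by some `k`-oscillating run of `P`. -/
noncomputable def PDA.oscLang {Q σ Γ : Type} (P : PDA Q σ Γ) (k : ℕ) : Set (List σ) :=
  { w | ∃ r, P.IsRun w r ∧ oscQR r = k }

/-- A PDA is in reduced form if it has a single state (`Q = PUnit`) and each action
pops a symbol (`ξ = ε`) or pushes two symbols (`ξ ∈ Γ²`). -/
def PDA.Reduced {σ Γ : Type} (P : PDA PUnit σ Γ) : Prop :=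
  ∀ a ∈ P.δ, (a.2.2.2.2 : List Γ).length = 2 ∨ a.2.2.2.2 = []

/-- For IDs `I, I'` with `stack(I) = ξ stack(I')`, `I/I' = (state(I), tape(I), ξ)`. -/
def quotID {Q σ Γ : Type} (I I' : ID Q σ Γ) : ID Q σ Γ :=
  ⟨I.state, I.tape, I.stack.take (I.stack.length - I'.stack.length)⟩

instance {σ Γ : Type} : Inhabited (ID PUnit σ Γ) := ⟨⟨PUnit.unit, [], []⟩⟩

/-- The segment `I_s/I_e, I_{s+1}/I_e, …, I_e/I_e` of a quasi-run `r = I₀, …, I_m`,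
for positions `s ≤ e`. -/
def segmentQR {σ Γ : Type} (r : List (ID PUnit σ Γ)) (s e : ℕ) : List (ID PUnit σ Γ) :=
  (List.range (e - s + 1)).map (fun j => quotID (r.getD (s + j) default) (r.getD e default))

/-!
STATEMENT 9 (Disassembly of quasi-runs): Let `r = I₀, I₁, …, I_m` be a quasi-run of a
one-state PDA with `m > 1`, and let `d = |stack(I₁)|`. Then there exist positions
`p₀ = 1 < p₁ < … < p_d = m`, where each `p_i` (`1 ≤ i ≤ d`) is the least position
(after `p_{i−1}`) with `stack(I_{p_i}) = (stack(I_{p_{i−1}}))_≪`, and for each `i` the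
sequence `r_i = I_{p_{i−1}}/I_{p_i}, …, I_{p_i}/I_{p_i}` is a quasi-run whose initial
stack content is the single symbol `(stack(I₁))_i`; thus `r` disassembles into its
first move `I₀ ⊢ I₁` and the `d` quasi-runs `r₁, …, r_d`.
-/

namespace PDA

variable {Q σ Γ : Type} {P : PDA Q σ Γ}

theorem Move.stack_ne_nil {I I' : ID Q σ Γ} (h : P.Move I I') : I.stack ≠ [] := by
  obtain ⟨b, γ, ξ, rest, -, hI, -⟩ := h
  simp [hI]

/-- A move preserves every suffix of the stack that does not contain the top symbol. -/
theorem Move.suffix {I I' : ID Q σ Γ} (h : P.Move I I') {l : List Γ} (hl : l <:+ I.stack)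
    (hlt : l.length < I.stack.length) : l <:+ I'.stack := by
  obtain ⟨b, γ, ξ, rest, -, hI, hI', -⟩ := h
  rw [hI] at hl hlt
  rw [hI']
  rcases List.suffix_cons_iff.1 hl with rfl | hl
  · simp at hlt
  · exact hl.trans (List.suffix_append _ _)

/-- A move above the stack of `J` induces a move between the quotients by `J`. -/
theorem Move.quotID {I I' : ID Q σ Γ} (h : P.Move I I') {J : ID Q σ Γ}
    (hJ : J.stack.length < I.stack.length) : P.Move (quotID I J) (quotID I' J) := by
  obtain ⟨b, γ, ξ, rest, hδ, hI, hI', ht⟩ := h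
  rw [hI, List.length_cons] at hJ
  refine ⟨b, γ, ξ, rest.take (rest.length - J.stack.length), hδ, ?_, ?_, ht⟩
  · simp only [_root_.quotID, hI, List.length_cons]
    rw [show rest.length + 1 - J.stack.length = (rest.length - J.stack.length) + 1 by lia,
      List.take_succ_cons]
  · simp only [_root_.quotID, hI', List.length_append]
    rw [show ξ.length + rest.length - J.stack.length
        = ξ.length + (rest.length - J.stack.length) by lia, List.take_length_add_append]

/-- A suffix of the stack survives as long as the stack stays strictly higher. -/
theorem suffix_of_moves {g : ℕ → ID Q σ Γ} {s e : ℕ} {l : List Γ}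
    (hs : l <:+ (g s).stack) (hse : s ≤ e)
    (hmove : ∀ j, s ≤ j → j < e → P.Move (g j) (g (j + 1)))
    (hlt : ∀ j, s ≤ j → j < e → l.length < (g j).stack.length) : l <:+ (g e).stack := by
  induction e, hse using Nat.le_induction with
  | base => exact hs
  | succ e hse ih =>
    exact (hmove e hse e.lt_succ_self).suffix
      (ih (fun j h h' => hmove j h (by lia)) fun j h h' => hlt j h (by lia))
      (hlt e hse e.lt_succ_self)

end PDA

theorem head?_segmentQR {σ Γ : Type} (r : List (ID PUnit σ Γ)) (s e : ℕ) :
    (segmentQR r s e).head? = some (quotID (r.getD s default) (r.getD e default)) := by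
  simp [segmentQR, List.head?_range]

theorem getLast?_segmentQR {σ Γ : Type} (r : List (ID PUnit σ Γ)) {s e : ℕ} (hse : s ≤ e) :
    (segmentQR r s e).getLast? = some (quotID (r.getD e default) (r.getD e default)) := by
  simp [segmentQR, List.getLast?_range, Nat.add_sub_cancel' hse]

/-- A segment whose stack drops for the first time below its initial height at its end is a
quasi-run. -/
theorem PDA.isQuasiRun_segmentQR {σ Γ : Type} {P : PDA PUnit σ Γ} {r : List (ID PUnit σ Γ)}
    {s e : ℕ} (hse : s ≤ e) {γ : Γ}
    (hγ : (quotID (r.getD s default) (r.getD e default)).stack = [γ])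
    (hmove : ∀ j, s ≤ j → j < e → P.Move (r.getD j default) (r.getD (j + 1) default))
    (hlt : ∀ j, s ≤ j → j < e →
      (r.getD e default).stack.length < (r.getD j default).stack.length) :
    P.IsQuasiRun (segmentQR r s e) := by
  refine ⟨?_, ⟨_, γ, head?_segmentQR r s e, hγ⟩, ⟨_, getLast?_segmentQR r hse, by simp [quotID]⟩⟩
  refine List.isChain_iff_getElem.2 fun j hj => ?_
  have hj' : j < e - s := by simpa [segmentQR] using hj
  simp only [segmentQR, List.getElem_map, List.getElem_range]
  exact (hmove (s + j) (by lia) (by lia)).quotID (hlt (s + j) (by lia) (by lia))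

theorem disassembly_of_quasiRuns {σ Γ : Type} [Finite σ] [Finite Γ]
    (P : PDA PUnit σ Γ) (r : List (ID PUnit σ Γ)) (m : ℕ)
    (hr : P.IsQuasiRun r) (hlen : r.length = m + 1) (hm : 1 < m)
    (I₁ : ID PUnit σ Γ) (hI₁ : r[1]? = some I₁) (d : ℕ) (hd : I₁.stack.length = d) :
    ∃ p : ℕ → ℕ,
      p 0 = 1 ∧ p d = m ∧
      (∀ i, 1 ≤ i → i ≤ d → p (i - 1) < p i) ∧
      -- each p_i is the least position after p_{i-1} where the stack equals
      -- the left-shift (tail) of the stack at p_{i-1}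
      (∀ i, 1 ≤ i → i ≤ d → ∀ J J' : ID PUnit σ Γ,
        r[p (i - 1)]? = some J' → r[p i]? = some J →
        J.stack = J'.stack.tail ∧
        ∀ j, p (i - 1) < j → j < p i → ∀ K : ID PUnit σ Γ,
          r[j]? = some K → K.stack ≠ J'.stack.tail) ∧
      -- each segment r_i is a quasi-run whose initial stack content is the single
      -- symbol (stack(I₁))_i
      (∀ i, 1 ≤ i → i ≤ d →
        P.IsQuasiRun (segmentQR r (p (i - 1)) (p i)) ∧
        ∃ γ : Γ, I₁.stack[i - 1]? = some γ ∧
          ∃ J : ID PUnit σ Γ, (segmentQR r (p (i - 1)) (p i)).head? = some J ∧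
            J.stack = [γ]) := by
  obtain ⟨hchain, -, L, hL, hLs⟩ := hr
  set g : ℕ → ID PUnit σ Γ := fun j => r.getD j default with hg
  have hget : ∀ {j J}, r[j]? = some J → J = g j := by
    intro j J h
    simp [hg, h]
  have hmove : ∀ j < m, P.Move (g j) (g (j + 1)) := by
    intro j hj
    have := List.isChain_iff_getElem.1 hchain j (by lia)
    simpa [hg, List.getElem?_eq_getElem (show j < r.length by lia),
      List.getElem?_eq_getElem (show j + 1 < r.length by lia)] using this
  have hgm : (g m).stack = [] := by
    rw [List.getLast?_eq_getElem?, hlen, Nat.add_sub_cancel] at hL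
    rw [← hget hL, hLs]
  obtain rfl := hget hI₁
  let p : ℕ → ℕ := fun i => sInf {j | 1 ≤ j ∧ (g j).stack.length ≤ d - i}
  have hne : ∀ i, m ∈ {j | 1 ≤ j ∧ (g j).stack.length ≤ d - i} := by
    intro i
    simp [hgm, hm.le]
  have hp : ∀ i, 1 ≤ p i ∧ (g (p i)).stack.length ≤ d - i := fun i => Nat.sInf_mem ⟨m, hne i⟩
  have hpm : ∀ i, p i ≤ m := fun i => Nat.sInf_le (hne i)
  have hlt : ∀ i j, 1 ≤ j → j < p i → d - i < (g j).stack.length := by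
    intro i j h1 hj
    by_contra! h
    exact Nat.notMem_of_lt_sInf hj ⟨h1, h⟩
  have hstack : ∀ i ≤ d, (g (p i)).stack = (g 1).stack.drop i := by
    intro i hi
    have hlen' : ((g 1).stack.drop i).length = d - i := by simp [hd]
    refine (List.IsSuffix.eq_of_length_le ?_ (by rw [hlen']; exact (hp i).2)).symm
    refine PDA.suffix_of_moves (List.drop_suffix _ _) (hp i).1
      (fun j _ hj => hmove j (hj.trans_le (hpm i))) fun j h1 hj => ?_
    rw [hlen']
    exact hlt i j h1 hj
  have hplen : ∀ i ≤ d, (g (p i)).stack.length = d - i := by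
    intro i hi
    rw [hstack i hi, List.length_drop, hd]
  have hplt : ∀ i, 1 ≤ i → i ≤ d → p (i - 1) < p i := by
    intro i h1 hi
    have hle : p (i - 1) ≤ p i := Nat.sInf_le ⟨(hp i).1, (hp i).2.trans (by lia)⟩
    refine hle.lt_of_ne fun h => ?_
    have h2 := hplen (i - 1) (by lia)
    rw [h, hplen i hi] at h2
    lia
  refine ⟨p, ?_, ?_, hplt, ?_, ?_⟩
  · exact le_antisymm (Nat.sInf_le ⟨le_rfl, by simp [hd]⟩) (hp 0).1
  · refine (hpm d).eq_of_not_lt fun h => (hmove _ h).stack_ne_nil ?_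
    rw [hstack d le_rfl, List.drop_eq_nil_iff, hd]
  · intro i h1 hi J J' hJ' hJ
    obtain rfl := hget hJ'
    obtain rfl := hget hJ
    have htail : (g (p i)).stack = (g (p (i - 1))).stack.tail := by
      rw [hstack i hi, hstack (i - 1) (by lia), List.tail_drop, Nat.sub_add_cancel h1]
    refine ⟨htail, fun j hj hj' K hK h => ?_⟩
    obtain rfl := hget hK
    have := hlt i j ((hp (i - 1)).1.trans hj.le) hj'
    rw [h, ← htail, hplen i hi] at this
    exact this.false
  · intro i h1 hi
    have hi' : i - 1 < (g 1).stack.length := by lia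
    have hγ : (quotID (g (p (i - 1))) (g (p i))).stack = [(g 1).stack[i - 1]] := by
      simp only [quotID]
      rw [hplen i hi, hplen (i - 1) (by lia), show d - (i - 1) - (d - i) = 1 by lia,
        hstack (i - 1) (by lia), List.drop_eq_getElem_cons hi', List.take_succ_cons, List.take_zero]
    refine ⟨P.isQuasiRun_segmentQR (hplt i h1 hi).le hγ
      (fun j _ hj => hmove j (hj.trans_le (hpm i))) fun j hj hj' => ?_,
      _, List.getElem?_eq_getElem hi', _, head?_segmentQR _ _ _, hγ⟩
    exact (hplen i hi).trans_lt (hlt i j ((hp (i - 1)).1.trans hj) hj')
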